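/- arXiv:1511.05357 — 6 statements merged into one kernel-verified Lean document; each statement's English description precedes it below -/
import Mathlib

section
/- Let P and Q be probability measures on a measurable space Ω with P absolutely continuous with respect to Q, and let A ⊆ Ω be a measurable set (the acceptance region of a deterministic binary hypothesis test). Put α := P(Ω \ A) (the missed-detection probability, so the detection probability is 1−α) and β := Q(A) (the false-alarm probability), and assume 0 < α < 1 and 0 < β < 1. Then D(α, β) := α log₂(α/(1−β)) + (1−α) log₂((1−α)/β) is at most the Kullback–Leibler divergence D_KL(P‖Q) measured in bits. That is, the detection probability 1−α and false-alarm probability β of any binary hypothesis test satisfy D(α,β) ≤ D_KL(P‖Q). -/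
open MeasureTheory
open scoped ENNReal Classical

/-- The Kullback–Leibler divergence `D_KL(P‖Q)` measured in bits, i.e.
`∫ log₂ (dP/dQ) dP` when `P ≪ Q` and the integrand is `P`-integrable, and `∞` otherwise. -/
noncomputable def klDivBits {Ω : Type*} [MeasurableSpace Ω] (P Q : Measure Ω) : ℝ≥0∞ :=
  if P ≪ Q ∧ Integrable (fun x => Real.logb 2 (P.rnDeriv Q x).toReal) P then
    ENNReal.ofReal (∫ x, Real.logb 2 (P.rnDeriv Q x).toReal ∂P)
  else ⊤

theorem mul_log_add_one_sub_le_mul_log {x c : ℝ} (hx : 0 ≤ x) (hc : 0 < c) :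
    x * (Real.log c + 1) - c ≤ x * Real.log x := by
  rcases hx.eq_or_lt with rfl | hx
  · simpa using hc.le
  · have h := mul_le_mul_of_nonneg_left (Real.log_le_sub_one_of_pos (div_pos hc hx)) hx.le
    rw [Real.log_div hc.ne' hx.ne', mul_sub, mul_sub, mul_div_cancel₀ _ hx.ne'] at h
    linarith

/-- The log-sum inequality for the log-likelihood ratio on a measurable set. -/
theorem mul_log_div_le_setIntegral_log_rnDeriv {Ω : Type*} [MeasurableSpace Ω] {P Q : Measure Ω}
    [IsFiniteMeasure P] [IsFiniteMeasure Q] (hac : P ≪ Q)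
    (hint : Integrable (fun x => Real.log (P.rnDeriv Q x).toReal) P)
    {B : Set Ω} (hB : MeasurableSet B) (hP : 0 < P.real B) (hQ : 0 < Q.real B) :
    P.real B * Real.log (P.real B / Q.real B) ≤
      ∫ x in B, Real.log (P.rnDeriv Q x).toReal ∂P := by
  set c := P.real B / Q.real B with hc
  have hc0 : 0 < c := div_pos hP hQ
  have hint' : Integrable (fun x => (P.rnDeriv Q x).toReal * Real.log (P.rnDeriv Q x).toReal) Q :=
    (integrable_rnDeriv_smul_iff hac).2 hint
  have hlin : IntegrableOn (fun x => (P.rnDeriv Q x).toReal * (Real.log c + 1)) B Q :=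
    (Measure.integrable_toReal_rnDeriv.mul_const _).integrableOn
  have hmono := setIntegral_mono (hlin.sub (integrable_const c)) hint'.integrableOn
    (fun x => mul_log_add_one_sub_le_mul_log (x := (P.rnDeriv Q x).toReal)
      ENNReal.toReal_nonneg hc0)
  have hright : ∫ x in B, (P.rnDeriv Q x).toReal * Real.log (P.rnDeriv Q x).toReal ∂Q =
      ∫ x in B, Real.log (P.rnDeriv Q x).toReal ∂P :=
    setIntegral_rnDeriv_smul hac hB
  have hleft : ∫ x in B, ((P.rnDeriv Q x).toReal * (Real.log c + 1) - c) ∂Q =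
      P.real B * (Real.log c + 1) - Q.real B * c := by
    rw [integral_sub hlin (integrable_const c), integral_mul_const,
      Measure.setIntegral_toReal_rnDeriv hac, setIntegral_const, smul_eq_mul]
  have hcancel : Q.real B * c = P.real B := mul_div_cancel₀ _ hQ.ne'
  rw [hright] at hmono
  have hmono' := hleft.symm.trans_le hmono
  linarith

/-- **Lemma 1 (Neyman–Pearson / data-processing bound for binary hypothesis testing).**
Let `P` and `Q` be probability measures on `Ω` with `P ≪ Q`, and let `A` be a measurable set
(the acceptance region of a deterministic binary hypothesis test). Put `α := P(Ω \ A)` (the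
missed-detection probability, so the detection probability is `1 − α`) and `β := Q(A)` (the
false-alarm probability), and assume `0 < α < 1`, `0 < β < 1`.
Then `D(α, β) := α log₂(α/(1−β)) + (1−α) log₂((1−α)/β) ≤ D_KL(P‖Q)` in bits. -/
theorem hypothesis_testing_kl_divergence_bound
    {Ω : Type*} [MeasurableSpace Ω] (P Q : Measure Ω)
    [IsProbabilityMeasure P] [IsProbabilityMeasure Q]
    (hac : P ≪ Q) (A : Set Ω) (hA : MeasurableSet A)
    (α β : ℝ) (hα : α = (P Aᶜ).toReal) (hβ : β = (Q A).toReal)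
    (hα0 : 0 < α) (hα1 : α < 1) (hβ0 : 0 < β) (hβ1 : β < 1) :
    ENNReal.ofReal (α * Real.logb 2 (α / (1 - β)) + (1 - α) * Real.logb 2 ((1 - α) / β))
      ≤ klDivBits P Q := by
  unfold klDivBits
  split_ifs with h
  · apply ENNReal.ofReal_le_ofReal
    have hlog2 : 0 < Real.log 2 := Real.log_pos one_lt_two
    have hint : Integrable (fun x => Real.log (P.rnDeriv Q x).toReal) P := by
      simpa [Real.logb, div_mul_cancel₀ _ hlog2.ne'] using h.2.mul_const (Real.log 2)
    have hPc : P.real Aᶜ = α := hα.symm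
    have hQA : Q.real A = β := hβ.symm
    have hPA : P.real A = 1 - α := by
      rw [← hPc, probReal_compl_eq_one_sub hA, sub_sub_cancel]
    have hQc : Q.real Aᶜ = 1 - β := by rw [probReal_compl_eq_one_sub hA, hQA]
    have hA_le := mul_log_div_le_setIntegral_log_rnDeriv hac hint hA
      (by linarith) (by linarith)
    have hAc_le := mul_log_div_le_setIntegral_log_rnDeriv hac hint hA.compl
      (by linarith) (by linarith)
    rw [hPA, hQA] at hA_le
    rw [hPc, hQc] at hAc_le
    have hsum := integral_add_compl hA hint
    simp only [Real.logb, integral_div, ← mul_div_assoc, ← add_div]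
    gcongr
    linarith
  · exact le_top
end

section
/- Let 𝒦, 𝒴, 𝒯 be finite nonempty types and let p be a joint probability mass function of (K, Y, T), where K is the secret key, Y represents the r previously observed ANA-MAC tags T̃^r, and T is the legitimate (r+1)-th tag T̃_{r+1}. Let V ⊆ 𝒦 × 𝒯 be the verification (acceptance) set, let the completeness error be α := P((K,T) ∉ V), and let the opponent, upon observing Y = y, insert a tag drawn from the conditional distribution p_{T|Y}(·|y), so the deception probability is p_r := ∑_y p_Y(y) ∑_{k,t} p_{K|Y}(k|y) · p_{T|Y}(t|y) · 1[(k,t) ∈ V]. Assume 0 < α < 1 and 0 < p_r < 1. Then D(α, p_r) := α log₂(α/(1−p_r)) + (1−α) log₂((1−α)/p_r) ≤ I(K; T | Y), i.e. D(α, p_r) ≤ I(K; T̃_{r+1} | T̃^r). -/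
open Finset
open scoped Classical

noncomputable section

variable {𝒦 𝒴 𝒯 : Type*} [Fintype 𝒦] [Fintype 𝒴] [Fintype 𝒯]

/-- Marginal pmf of `Y` for a joint pmf `p` of `(K, Y, T)`. -/
def margY (p : 𝒦 × 𝒴 × 𝒯 → ℝ) (y : 𝒴) : ℝ := ∑ k, ∑ t, p (k, y, t)

/-- Marginal pmf of `(K, Y)` for a joint pmf `p` of `(K, Y, T)`. -/
def margKY (p : 𝒦 × 𝒴 × 𝒯 → ℝ) (k : 𝒦) (y : 𝒴) : ℝ := ∑ t, p (k, y, t)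

/-- Marginal pmf of `(Y, T)` for a joint pmf `p` of `(K, Y, T)`. -/
def margYT (p : 𝒦 × 𝒴 × 𝒯 → ℝ) (y : 𝒴) (t : 𝒯) : ℝ := ∑ k, p (k, y, t)

/-- The conditional mutual information `I(K; T | Y)` in bits of a joint pmf `p` of `(K, Y, T)`:
`I(K;T|Y) = ∑_{k,y,t} p(k,y,t) log₂( p(k,t|y) / (p(k|y)·p(t|y)) )`, terms with zero
probability being `0` (as guaranteed by the conventions `log₂ 0 = 0` and `x/0 = 0`). -/
def condMI (p : 𝒦 × 𝒴 × 𝒯 → ℝ) : ℝ :=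
  ∑ k, ∑ y, ∑ t, p (k, y, t) *
    Real.logb 2 (p (k, y, t) * margY p y / (margKY p k y * margYT p y t))

theorem mul_log_add_sub_le_mul_log_div {p q c : ℝ} (hp : 0 ≤ p) (hq : 0 ≤ q)
    (hpq : p ≠ 0 → q ≠ 0) (hc : 0 < c) :
    p * Real.log c + p - q * c ≤ p * Real.log (p / q) := by
  rcases hp.eq_or_lt with rfl | hp
  · simpa using mul_nonneg hq hc.le
  have hq : 0 < q := lt_of_le_of_ne hq (Ne.symm (hpq hp.ne'))
  have h := Real.log_le_sub_one_of_pos (div_pos (mul_pos hq hc) hp)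
  rw [Real.log_div (by positivity) hp.ne', Real.log_mul hq.ne' hc.ne'] at h
  rw [Real.log_div hp.ne' hq.ne']
  have h' := mul_le_mul_of_nonneg_left h hp.le
  have e : p * (q * c / p - 1) = q * c - p := by field_simp
  linarith

/-- Data processing for the relative entropy of `p` with respect to `q` under a binary test. -/
theorem binary_relative_entropy_le {ι : Type*} [Fintype ι] (p q : ι → ℝ)
    (hp : ∀ i, 0 ≤ p i) (hq : ∀ i, 0 ≤ q i) (hpq : ∀ i, p i ≠ 0 → q i ≠ 0)
    (hp_sum : ∑ i, p i = 1) (hq_sum : ∑ i, q i = 1) (A : ι → Prop) [DecidablePred A]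
    {a b : ℝ} (ha : a = ∑ i, if A i then 0 else p i) (hb : b = ∑ i, if A i then q i else 0)
    (ha0 : 0 < a) (ha1 : a < 1) (hb0 : 0 < b) (hb1 : b < 1) :
    a * Real.logb 2 (a / (1 - b)) + (1 - a) * Real.logb 2 ((1 - a) / b) ≤
      ∑ i, p i * Real.logb 2 (p i / q i) := by
  have ha' : 1 - a = ∑ i, if A i then p i else 0 := by
    rw [← hp_sum, ha, ← Finset.sum_sub_distrib]
    exact Finset.sum_congr rfl fun i _ => by split_ifs <;> simp
  have hb' : 1 - b = ∑ i, if A i then 0 else q i := by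
    rw [← hq_sum, hb, ← Finset.sum_sub_distrib]
    exact Finset.sum_congr rfl fun i _ => by split_ifs <;> simp
  have h1a : 0 < 1 - a := sub_pos.2 ha1
  have h1b : 0 < 1 - b := sub_pos.2 hb1
  set c : ι → ℝ := fun i => if A i then (1 - a) / b else a / (1 - b) with hc_def
  have hc : ∀ i, 0 < c i := fun i => by
    simp only [hc_def]; split_ifs <;> positivity
  have hle := Finset.sum_le_sum fun i (_ : i ∈ Finset.univ) =>
    mul_log_add_sub_le_mul_log_div (hp i) (hq i) (hpq i) (hc i)
  have hlog : ∑ i, p i * Real.log (c i) =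
      a * Real.log (a / (1 - b)) + (1 - a) * Real.log ((1 - a) / b) := by
    conv_rhs => enter [1, 1]; rw [ha]
    conv_rhs => enter [2, 1]; rw [ha']
    rw [Finset.sum_mul, Finset.sum_mul, ← Finset.sum_add_distrib]
    exact Finset.sum_congr rfl fun i _ => by simp only [hc_def]; split_ifs <;> simp
  have hqc : ∑ i, q i * c i = 1 := by
    calc ∑ i, q i * c i = b * ((1 - a) / b) + (1 - b) * (a / (1 - b)) := by
          conv_rhs => enter [1, 1]; rw [hb]
          conv_rhs => enter [2, 1]; rw [hb']
          rw [Finset.sum_mul, Finset.sum_mul, ← Finset.sum_add_distrib]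
          exact Finset.sum_congr rfl fun i _ => by simp only [hc_def]; split_ifs <;> simp
      _ = 1 := by field_simp; ring
  rw [Finset.sum_sub_distrib, Finset.sum_add_distrib, hlog, hp_sum, hqc] at hle
  have h2 : 0 < Real.log 2 := Real.log_pos one_lt_two
  simp only [Real.logb, ← mul_div_assoc, ← add_div, ← Finset.sum_div]
  exact div_le_div_of_nonneg_right (by linarith) h2.le

theorem sum_margKY {𝒦 𝒴 𝒯 : Type*} [Fintype 𝒦] [Fintype 𝒯] (p : 𝒦 × 𝒴 × 𝒯 → ℝ) (y : 𝒴) :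
    ∑ k, margKY p k y = margY p y := rfl

theorem sum_margYT {𝒦 𝒴 𝒯 : Type*} [Fintype 𝒦] [Fintype 𝒯] (p : 𝒦 × 𝒴 × 𝒯 → ℝ) (y : 𝒴) :
    ∑ t, margYT p y t = margY p y :=
  Finset.sum_comm

theorem sum_margY (p : 𝒦 × 𝒴 × 𝒯 → ℝ) : ∑ y, margY p y = ∑ x, p x := by
  simp only [margY, Fintype.sum_prod_type]
  exact Finset.sum_comm

/-- **Theorem 3 (lower bound on the deception probability of a spoofing attack on an ANA-MAC).**
`K` is the secret key, `Y` the `r` previously observed ANA-MAC tags `T̃^r`, `T` the legitimate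
`(r+1)`-th tag `T̃_{r+1}`, jointly distributed according to a pmf `p`; `V ⊆ 𝒦 × 𝒯` is the
verification (acceptance) set, `α := P((K,T) ∉ V)` is the completeness error, and the opponent,
upon observing `Y = y`, inserts a tag drawn from `p_{T|Y}(·|y)`, giving deception probability
`p_r := ∑_y p_Y(y) ∑_{k,t} p_{K|Y}(k|y) p_{T|Y}(t|y) 1[(k,t) ∈ V]`. If `0 < α < 1` and
`0 < p_r < 1`, then `D(α, p_r) ≤ I(K; T̃_{r+1} | T̃^r)`. -/
theorem ana_mac_spoofing_deception_bound
    [Nonempty 𝒦] [Nonempty 𝒴] [Nonempty 𝒯]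
    (p : 𝒦 × 𝒴 × 𝒯 → ℝ) (hp : ∀ x, 0 ≤ p x) (hsum : ∑ x : 𝒦 × 𝒴 × 𝒯, p x = 1)
    (V : Finset (𝒦 × 𝒯))
    (α : ℝ) (hα : α = ∑ k, ∑ y, ∑ t, if (k, t) ∈ V then 0 else p (k, y, t))
    (pr : ℝ)
    (hpr : pr = ∑ y, margY p y * ∑ k, ∑ t,
      (margKY p k y / margY p y) * ((margYT p y t / margY p y) *
        (if (k, t) ∈ V then 1 else 0)))
    (hα0 : 0 < α) (hα1 : α < 1) (hpr0 : 0 < pr) (hpr1 : pr < 1) :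
    α * Real.logb 2 (α / (1 - pr)) + (1 - α) * Real.logb 2 ((1 - α) / pr) ≤ condMI p := by
  have hKY : ∀ k y, 0 ≤ margKY p k y := fun k y => Finset.sum_nonneg fun t _ => hp _
  have hYT : ∀ y t, 0 ≤ margYT p y t := fun y t => Finset.sum_nonneg fun k _ => hp _
  have hY : ∀ y, 0 ≤ margY p y := fun y => Finset.sum_nonneg fun k _ => hKY k y
  set q : 𝒦 × 𝒴 × 𝒯 → ℝ := fun x =>
    margKY p x.1 x.2.1 * margYT p x.2.1 x.2.2 / margY p x.2.1 with hq_def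
  have hq : ∀ x, 0 ≤ q x := fun x => div_nonneg (mul_nonneg (hKY _ _) (hYT _ _)) (hY _)
  have hpq : ∀ x, p x ≠ 0 → q x ≠ 0 := by
    rintro ⟨k, y, t⟩ hx
    have hx : 0 < p (k, y, t) := lt_of_le_of_ne (hp _) hx.symm
    have h1 : 0 < margKY p k y :=
      hx.trans_le (Finset.single_le_sum (f := fun t => p (k, y, t)) (fun t _ => hp _)
        (Finset.mem_univ t))
    have h2 : 0 < margYT p y t :=
      hx.trans_le (Finset.single_le_sum (f := fun k => p (k, y, t)) (fun k _ => hp _)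
        (Finset.mem_univ k))
    have h3 : 0 < margY p y :=
      h1.trans_le (Finset.single_le_sum (f := fun k => margKY p k y) (fun k _ => hKY k y)
        (Finset.mem_univ k))
    exact (div_pos (mul_pos h1 h2) h3).ne'
  have hq_sum : ∑ x, q x = 1 := by
    rw [← hsum, ← sum_margY]
    simp only [hq_def, Fintype.sum_prod_type]
    rw [Finset.sum_comm]
    refine Finset.sum_congr rfl fun y _ => ?_
    calc ∑ k, ∑ t, margKY p k y * margYT p y t / margY p y
        = (∑ k, margKY p k y) * (∑ t, margYT p y t) / margY p y := by
          simp only [Finset.sum_mul_sum, Finset.sum_div]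
      _ = margY p y := by rw [sum_margKY, sum_margYT, mul_self_div_self]
  have hb : pr = ∑ x : 𝒦 × 𝒴 × 𝒯, if (x.1, x.2.2) ∈ V then q x else 0 := by
    simp only [hpr, hq_def, Fintype.sum_prod_type, Finset.mul_sum]
    rw [Finset.sum_comm]
    refine Finset.sum_congr rfl fun k _ => Finset.sum_congr rfl fun y _ =>
      Finset.sum_congr rfl fun t _ => ?_
    rcases eq_or_ne (margY p y) 0 with h | h
    · simp [h]
    · split_ifs
      · field_simp
      · simp
  have ha : α = ∑ x : 𝒦 × 𝒴 × 𝒯, if (x.1, x.2.2) ∈ V then 0 else p x := by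
    simp only [hα, Fintype.sum_prod_type]
  refine (binary_relative_entropy_le p q hp hq hpq hsum hq_sum
    (fun x => (x.1, x.2.2) ∈ V) ha hb hα0 hα1 hpr0 hpr1).trans_eq ?_
  simp only [condMI, hq_def, Fintype.sum_prod_type, div_div_eq_mul_div]

end
end

section
/- Let 𝒦, 𝒴, 𝒯 be finite nonempty types and let p be a joint probability mass function of (K, Y, T), where K is the secret key, Y represents the r previously observed ANA-MAC tags T̃^r, and T is the legitimate (r+1)-th tag T̃_{r+1}. Let V ⊆ 𝒦 × 𝒯 be the verification (acceptance) set and assume the completeness error is zero, i.e. (k,t) ∈ V whenever p(k,y,t) > 0 for some y. Let the opponent, upon observing Y = y, insert a tag drawn from the conditional distribution p_{T|Y}(·|y), so the deception probability is p_r := ∑_y p_Y(y) ∑_{k,t} p_{K|Y}(k|y) · p_{T|Y}(t|y) · 1[(k,t) ∈ V]. Then p_r ≥ 2^{−I(K; T | Y)}, i.e. p_r ≥ 2^{−I(K; T̃_{r+1} | T̃^r)}. -/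
open Finset
open scoped Classical

noncomputable section

variable {𝒦 𝒴 𝒯 : Type*} [Fintype 𝒦] [Fintype 𝒴] [Fintype 𝒯]

/-- A weighted AM-GM inequality in exponential form: for a pmf `w` and positive ratios `x` on its
support, `b` to the power minus the `w`-average of `log_b x` is at most the `w`-average of `1/x`. -/
lemma rpow_neg_sum_mul_logb_le {ι : Type*} (s : Finset ι) (w x : ι → ℝ) {b : ℝ} (hb : 1 < b)
    (hw : ∀ i ∈ s, 0 ≤ w i) (hsum : ∑ i ∈ s, w i = 1) (hx : ∀ i ∈ s, 0 < w i → 0 < x i) :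
    b ^ (-∑ i ∈ s, w i * Real.logb b (x i)) ≤ ∑ i ∈ s, w i * (x i)⁻¹ := by
  have hb0 : 0 < b := zero_lt_one.trans hb
  have jensen := (convexOn_rpow_left hb0).map_sum_le (p := fun i => -Real.logb b (x i))
    hw hsum (fun i _ => Set.mem_univ _)
  simp only [smul_eq_mul, mul_neg, Finset.sum_neg_distrib] at jensen
  refine jensen.trans_eq (Finset.sum_congr rfl fun i hi => ?_)
  rcases (hw i hi).eq_or_lt with h | h
  · simp [← h]
  · rw [Real.rpow_neg hb0.le, Real.rpow_logb hb0 hb.ne' (hx i hi h)]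

/-- **Theorem 3, zero-completeness case: `p_r ≥ 2^{−I(K; T̃_{r+1} | T̃^r)}`.**
`K` is the secret key, `Y` the `r` previously observed ANA-MAC tags `T̃^r`, `T` the legitimate
`(r+1)`-th tag `T̃_{r+1}`, jointly distributed according to a pmf `p`; `V ⊆ 𝒦 × 𝒯` is the
verification (acceptance) set, with zero completeness error (every legitimate tag is accepted:
`(k,t) ∈ V` whenever `p(k,y,t) > 0` for some `y`). The opponent, upon observing `Y = y`,
inserts a tag drawn from `p_{T|Y}(·|y)`, giving deception probability
`p_r := ∑_y p_Y(y) ∑_{k,t} p_{K|Y}(k|y) p_{T|Y}(t|y) 1[(k,t) ∈ V]`.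
Then `p_r ≥ 2^{−I(K; T | Y)}`. -/
theorem ana_mac_spoofing_deception_bound_zero_completeness
    [Nonempty 𝒦] [Nonempty 𝒴] [Nonempty 𝒯]
    (p : 𝒦 × 𝒴 × 𝒯 → ℝ) (hp : ∀ x, 0 ≤ p x) (hsum : ∑ x : 𝒦 × 𝒴 × 𝒯, p x = 1)
    (V : Finset (𝒦 × 𝒯))
    (hV : ∀ k y t, 0 < p (k, y, t) → (k, t) ∈ V)
    (pr : ℝ)
    (hpr : pr = ∑ y, margY p y * ∑ k, ∑ t,
      (margKY p k y / margY p y) * ((margYT p y t / margY p y) *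
        (if (k, t) ∈ V then 1 else 0))) :
    pr ≥ (2 : ℝ) ^ (-condMI p) := by
  have hKY : ∀ k y t, p (k, y, t) ≤ margKY p k y := fun k y t =>
    Finset.single_le_sum (f := fun t => p (k, y, t)) (fun _ _ => hp _) (Finset.mem_univ t)
  have hYT : ∀ k y t, p (k, y, t) ≤ margYT p y t := fun k y t =>
    Finset.single_le_sum (f := fun k => p (k, y, t)) (fun _ _ => hp _) (Finset.mem_univ k)
  have hY : ∀ k y, margKY p k y ≤ margY p y := fun k y =>
    Finset.single_le_sum (f := fun k => margKY p k y)
      (fun _ _ => Finset.sum_nonneg fun _ _ => hp _) (Finset.mem_univ k)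
  have hcond : condMI p = ∑ x : 𝒦 × 𝒴 × 𝒯, p x * Real.logb 2
      (p x * margY p x.2.1 / (margKY p x.1 x.2.1 * margYT p x.2.1 x.2.2)) := by
    simp only [condMI, Fintype.sum_prod_type]
  have hpr' : pr = ∑ x : 𝒦 × 𝒴 × 𝒯, margY p x.2.1 *
      ((margKY p x.1 x.2.1 / margY p x.2.1) * ((margYT p x.2.1 x.2.2 / margY p x.2.1) *
        (if (x.1, x.2.2) ∈ V then 1 else 0))) := by
    simp only [hpr, Fintype.sum_prod_type, Finset.mul_sum]
    exact Finset.sum_comm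
  rw [ge_iff_le, hcond, hpr']
  refine (rpow_neg_sum_mul_logb_le Finset.univ p _ one_lt_two (fun x _ => hp x) hsum ?_).trans
    (Finset.sum_le_sum ?_)
  · rintro ⟨k, y, t⟩ - h
    have h₁ := h.trans_le (hKY k y t)
    have h₂ := h.trans_le (hYT k y t)
    have h₃ := h₁.trans_le (hY k y)
    positivity
  · rintro ⟨k, y, t⟩ -
    rcases (hp (k, y, t)).eq_or_lt with h | h
    · have h₁ := (hp _).trans (hKY k y t)
      have h₂ := (hp _).trans (hYT k y t)
      have h₃ := h₁.trans (hY k y)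
      simp only [← h, zero_mul]
      positivity
    · have h₁ := h.trans_le (hKY k y t)
      have h₂ := h.trans_le (hYT k y t)
      have h₃ := h₁.trans_le (hY k y)
      refine le_of_eq ?_
      simp only [hV k y t h, if_true]
      field_simp

end
end

section
/- Let 𝒦, 𝒴 be finite nonempty types, let p be a joint probability mass function of (K, Y) (K the secret key, Y the r observed ANA-MAC tags T̃^r), and let f : 𝒦 → 𝒯 be a map into a finite type 𝒯 (the deterministic tag-generation map k ↦ ħ(k, s_{r+1}), so the clean tag is T_{r+1} = f(K)). Let the opponent, upon observing Y = y, insert the clean tag t maximizing the posterior validity probability, so the deception probability is p_r := ∑_y p_Y(y) · max_{t ∈ 𝒯} P(f(K) = t | Y = y). Then p_r ≥ 2^{−I(K; f(K) | Y)}, i.e. p_r ≥ 2^{−I(K; T_{r+1} | T̃^r)}. -/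
open Finset
open scoped Classical

noncomputable section

variable {𝒦 𝒴 𝒯 : Type*} [Fintype 𝒦] [Fintype 𝒴] [Fintype 𝒯]

/-- The joint pmf of `(K, Y, f(K))` obtained from a joint pmf `p` of `(K, Y)` and a
deterministic map `f : 𝒦 → 𝒯`. -/
def jointWithClean (p : 𝒦 × 𝒴 → ℝ) (f : 𝒦 → 𝒯) : 𝒦 × 𝒴 × 𝒯 → ℝ :=
  fun x => if f x.1 = x.2.2 then p (x.1, x.2.1) else 0

theorem margY_jointWithClean (p : 𝒦 × 𝒴 → ℝ) (f : 𝒦 → 𝒯) (y : 𝒴) :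
    margY (jointWithClean p f) y = ∑ k, p (k, y) := by
  simp [margY, jointWithClean]

theorem margKY_jointWithClean (p : 𝒦 × 𝒴 → ℝ) (f : 𝒦 → 𝒯) (k : 𝒦) (y : 𝒴) :
    margKY (jointWithClean p f) k y = p (k, y) := by
  simp [margKY, jointWithClean]

theorem margYT_jointWithClean (p : 𝒦 × 𝒴 → ℝ) (f : 𝒦 → 𝒯) (y : 𝒴) (t : 𝒯) :
    margYT (jointWithClean p f) y t = ∑ k, if f k = t then p (k, y) else 0 := rfl

/-- Since `f(K)` is determined by `K`, `-I(K; f(K) | Y)` is the expected logarithm of the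
posterior probability of `f(K)` given `Y`. -/
theorem neg_condMI_jointWithClean (p : 𝒦 × 𝒴 → ℝ) (f : 𝒦 → 𝒯) :
    -condMI (jointWithClean p f) = ∑ x : 𝒦 × 𝒴, p x *
      Real.logb 2 ((∑ k, if f k = f x.1 then p (k, x.2) else 0) / ∑ k, p (k, x.2)) := by
  simp only [condMI, margY_jointWithClean, margKY_jointWithClean, margYT_jointWithClean]
  rw [Fintype.sum_prod_type, ← sum_neg_distrib]
  refine sum_congr rfl fun k _ => ?_
  rw [← sum_neg_distrib]
  refine sum_congr rfl fun y _ => ?_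
  rw [sum_eq_single (f k) (fun t _ ht => by simp [jointWithClean, ht.symm]) (by simp)]
  rcases eq_or_ne (p (k, y)) 0 with h | h
  · simp [jointWithClean, h]
  · have hk : jointWithClean p f (k, y, f k) = p (k, y) := by simp [jointWithClean]
    rw [hk, mul_div_mul_left _ _ h, ← mul_neg, ← Real.logb_inv, inv_div]

/-- Jensen's inequality for the exponential with base `2`, in the form of a weighted inequality
between the geometric and the arithmetic mean. -/
theorem two_rpow_sum_mul_logb_le {ι : Type*} [Fintype ι] (p w : ι → ℝ) (hp : ∀ i, 0 ≤ p i)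
    (hsum : ∑ i, p i = 1) (hw : ∀ i, p i ≠ 0 → 0 < w i) :
    (2 : ℝ) ^ (∑ i, p i * Real.logb 2 (w i)) ≤ ∑ i, p i * w i := by
  refine ((convexOn_rpow_left (b := 2) two_pos).map_sum_le (t := univ)
    (p := fun i => Real.logb 2 (w i)) (fun i _ => hp i) hsum (by simp)).trans_eq ?_
  refine sum_congr rfl fun i _ => ?_
  rcases eq_or_ne (p i) 0 with h | h
  · simp [h]
  · simp [Real.rpow_logb two_pos (by norm_num) (hw i h)]

/-- **Theorem 4 (lower bound for a spoofing attack inserting a clean tag):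
`p_r ≥ 2^{−I(K; T_{r+1} | T̃^r)}`.**
`K` is the secret key (jointly distributed with the observed ANA-MAC tags `Y = T̃^r`
according to a pmf `p`), and `f : 𝒦 → 𝒯` is the deterministic tag-generation map
`k ↦ ħ(k, s_{r+1})`, so the clean tag is `T_{r+1} = f(K)`. The opponent, upon observing
`Y = y`, inserts the clean tag `t` maximizing the posterior validity probability
`P(f(K) = t | Y = y)`, giving deception probability
`p_r := ∑_y p_Y(y) · max_t P(f(K) = t | Y = y)`. Then `p_r ≥ 2^{−I(K; f(K) | Y)}`. -/
theorem ana_mac_clean_tag_spoofing_bound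
    [Nonempty 𝒦] [Nonempty 𝒴] [Nonempty 𝒯]
    (p : 𝒦 × 𝒴 → ℝ) (hp : ∀ x, 0 ≤ p x) (hsum : ∑ x : 𝒦 × 𝒴, p x = 1)
    (f : 𝒦 → 𝒯)
    (pr : ℝ)
    (hpr : pr = ∑ y, (∑ k, p (k, y)) *
      (univ.sup' univ_nonempty fun t : 𝒯 =>
        (∑ k, if f k = t then p (k, y) else 0) / ∑ k, p (k, y))) :
    pr ≥ (2 : ℝ) ^ (-condMI (jointWithClean p f)) := by
  rw [hpr, neg_condMI_jointWithClean, ge_iff_le]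
  refine (two_rpow_sum_mul_logb_le p _ hp hsum fun x hx => ?_).trans ?_
  · have hpos : 0 < p x := (hp x).lt_of_ne' hx
    refine div_pos (sum_pos' (fun k _ => ?_) ⟨x.1, mem_univ _, by simpa using hpos⟩)
      (sum_pos' (fun k _ => hp _) ⟨x.1, mem_univ _, hpos⟩)
    split_ifs
    exacts [hp _, le_rfl]
  · rw [Fintype.sum_prod_type_right]
    refine sum_le_sum fun y _ => ?_
    rw [sum_mul]
    refine sum_le_sum fun k _ => mul_le_mul_of_nonneg_left ?_ (hp _)
    exact le_sup' (fun t : 𝒯 => (∑ k, if f k = t then p (k, y) else 0) / ∑ k, p (k, y))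
      (mem_univ (f k))

end
end

section
/- Let C ⊆ 𝔽₂^l be a binary equidistant code: a finite set of words of length l with |C| = M ≥ 2 such that d_H(x, y) = d for all distinct x, y ∈ C. Then 2·d·(M − 1) ≤ l·M, i.e. d ≤ M·l / (2(M − 1)). (This is the bound achieved with equality by optimal equidistant codes, for which d_opt = M l / (2(M−1)).) -/
/-- Among the ordered pairs of elements of `C`, at most half are separated by a `ZMod 2`-valued
function. -/
theorem two_mul_sum_card_filter_ne_le {α : Type*} (C : Finset α) (f : α → ZMod 2) :
    2 * ∑ x ∈ C, (C.filter fun y => f x ≠ f y).card ≤ C.card ^ 2 := by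
  set a := (C.filter fun y => f y = 0).card with ha
  set b := (C.filter fun y => ¬ f y = 0).card with hb
  have hab : a + b = C.card := Finset.card_filter_add_card_filter_not _
  have hcount : ∀ x, (C.filter fun y => f x ≠ f y).card = if f x = 0 then b else a := by
    have hne : ∀ u v : ZMod 2, u ≠ v ↔ if u = 0 then ¬ v = 0 else v = 0 := by decide
    intro x
    simp only [hne (f x)]
    split_ifs <;> rfl
  simp only [hcount, Finset.sum_ite, Finset.sum_const, smul_eq_mul, ← ha, ← hb, ← hab]
  nlinarith [two_mul_le_add_sq a b]

/-- The sum of the Hamming distances over all ordered pairs of words of a binary code of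
length `|ι|` and size `M` is at most `|ι| M² / 2`. -/
theorem two_mul_sum_hammingDist_le {ι : Type*} [Fintype ι] (C : Finset (ι → ZMod 2)) :
    2 * ∑ x ∈ C, ∑ y ∈ C, hammingDist x y ≤ Fintype.card ι * C.card ^ 2 := by
  have hswap : ∑ x ∈ C, ∑ y ∈ C, hammingDist x y =
      ∑ i, ∑ x ∈ C, (C.filter fun y => x i ≠ y i).card := by
    simp only [hammingDist, Finset.card_filter]
    conv_rhs => rw [Finset.sum_comm]
    exact Finset.sum_congr rfl fun x _ => Finset.sum_comm
  rw [hswap, Finset.mul_sum, ← smul_eq_mul (Fintype.card ι)]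
  exact Finset.sum_le_card_nsmul _ _ _ fun i _ => two_mul_sum_card_filter_ne_le C fun x => x i

/-- The sum of the distances over all ordered pairs of words of an equidistant code. -/
theorem sum_hammingDist_of_equidistant {ι : Type*} [Fintype ι] {β : ι → Type*}
    [∀ i, DecidableEq (β i)] {C : Finset (∀ i, β i)} {d : ℕ}
    (hdist : ∀ x ∈ C, ∀ y ∈ C, x ≠ y → hammingDist x y = d) :
    ∑ x ∈ C, ∑ y ∈ C, hammingDist x y = C.card * ((C.card - 1) * d) := by
  classical
  refine Finset.sum_const_nat fun x hx => ?_
  rw [← Finset.add_sum_erase C _ hx, hammingDist_self, zero_add, ← Finset.card_erase_of_mem hx]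
  exact Finset.sum_const_nat fun y hy =>
    hdist x hx y (Finset.mem_of_mem_erase hy) (Finset.ne_of_mem_erase hy).symm

/-- **Plotkin-type bound for equidistant codes: `d ≤ M l / (2(M−1))`.**
Let `C ⊆ 𝔽₂^l` be a binary equidistant code: a finite set of words of length `l` with
`|C| = M ≥ 2` such that `d_H(x,y) = d` for all distinct `x, y ∈ C`. Then
`2·d·(M − 1) ≤ l·M`, the bound achieved with equality by optimal equidistant codes,
for which `d_opt = M l / (2(M−1))`. -/
theorem equidistant_code_distance_bound
    (l d M : ℕ) (C : Finset (Fin l → ZMod 2))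
    (hM : C.card = M) (hM2 : 2 ≤ M)
    (hdist : ∀ x ∈ C, ∀ y ∈ C, x ≠ y → hammingDist x y = d) :
    2 * d * (M - 1) ≤ l * M := by
  subst hM
  have h := two_mul_sum_hammingDist_le C
  rw [sum_hammingDist_of_equidistant hdist, Fintype.card_fin] at h
  refine le_of_mul_le_mul_left (a := C.card) ?_ (Nat.zero_lt_of_lt hM2)
  linarith
end

section
/- (Delsarte's bound for few-distance codes) Let C ⊆ 𝔽₂^l be a binary code of length l and suppose the set of distances {d_H(x,y) : x, y ∈ C, x ≠ y} has at most s elements. Then |C| ≤ ∑_{i=0}^{s} binom(l, i). -/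
/-- The span of the squarefree monomial functions of degree at most `k` on the binary cube. -/
def squarefreeMonomialSpan (l k : ℕ) : Submodule ℚ ((Fin l → ZMod 2) → ℚ) :=
  Submodule.span ℚ {f | ∃ S : Finset (Fin l), S.card ≤ k ∧
    f = fun x => ∏ i ∈ S, if x i = 0 then 0 else 1}

theorem squarefreeMonomialSpan_mono (l : ℕ) {k k' : ℕ} (h : k ≤ k') :
    squarefreeMonomialSpan l k ≤ squarefreeMonomialSpan l k' := by
  refine Submodule.span_mono ?_
  rintro f ⟨S, hS, rfl⟩
  exact ⟨S, hS.trans h, rfl⟩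

theorem coordinate_mul_mem_squarefreeMonomialSpan {l k : ℕ} (i : Fin l)
    {f : (Fin l → ZMod 2) → ℚ} (hf : f ∈ squarefreeMonomialSpan l k) :
    (fun x => (if x i = 0 then 0 else 1) * f x) ∈ squarefreeMonomialSpan l (k + 1) := by
  refine (Submodule.span_le (p := (squarefreeMonomialSpan l (k + 1)).comap
    (LinearMap.mulLeft ℚ fun x : Fin l → ZMod 2 => if x i = 0 then (0 : ℚ) else 1))).2 ?_ hf
  rintro f ⟨S, hS, rfl⟩
  refine Submodule.subset_span ⟨insert i S, (Finset.card_insert_le _ _).trans (by lia), ?_⟩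
  funext x
  by_cases hi : i ∈ S
  · rw [Finset.insert_eq_of_mem hi]
    by_cases hx : x i = 0
    · simp [hx, Finset.prod_eq_zero hi]
    · simp [hx]
  · simp [Finset.prod_insert hi]

theorem hammingDist_mul_mem_squarefreeMonomialSpan {l k : ℕ} (a : Fin l → ZMod 2)
    {f : (Fin l → ZMod 2) → ℚ} (hf : f ∈ squarefreeMonomialSpan l k) :
    (fun x => (hammingDist a x : ℚ) * f x) ∈ squarefreeMonomialSpan l (k + 1) := by
  have h : (fun x => (hammingDist a x : ℚ) * f x) =
      ∑ i, fun x => (if a i ≠ x i then 1 else 0) * f x := by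
    funext x
    simp only [Finset.sum_apply, ← Finset.sum_mul, hammingDist, Finset.card_filter]
    push_cast
    rfl
  rw [h]
  refine Submodule.sum_mem _ fun i _ => ?_
  have hi := coordinate_mul_mem_squarefreeMonomialSpan i hf
  by_cases ha : a i = 0
  · convert hi using 1
    funext x
    by_cases hx : x i = 0 <;> simp [ha, hx, Ne.symm]
  · convert Submodule.sub_mem _ (squarefreeMonomialSpan_mono l k.le_succ hf) hi using 1
    funext x
    have key : ∀ u v : ZMod 2, u ≠ 0 → (u ≠ v ↔ v = 0) := by decide
    by_cases hx : x i = 0 <;> simp only [key _ (x i) ha] <;> simp [hx]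

theorem prod_sub_hammingDist_mem_squarefreeMonomialSpan {l : ℕ} (a : Fin l → ZMod 2)
    (D : Finset ℕ) :
    (fun x => ∏ d ∈ D, ((d : ℚ) - hammingDist a x)) ∈ squarefreeMonomialSpan l D.card := by
  induction D using Finset.induction_on with
  | empty => exact Submodule.subset_span ⟨∅, by simp, by simp⟩
  | insert d D hd ih =>
    rw [Finset.card_insert_of_notMem hd]
    convert Submodule.sub_mem _
      (Submodule.smul_mem _ (d : ℚ) (squarefreeMonomialSpan_mono l (Nat.le_succ _) ih))
      (hammingDist_mul_mem_squarefreeMonomialSpan a ih) using 1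
    funext x
    simp [Finset.prod_insert hd, sub_mul]

theorem card_le_of_linearIndependent_mem_squarefreeMonomialSpan {l s : ℕ} {ι : Type*} [Fintype ι]
    {v : ι → (Fin l → ZMod 2) → ℚ} (hv : LinearIndependent ℚ v)
    (hmem : ∀ j, v j ∈ squarefreeMonomialSpan l s) :
    Fintype.card ι ≤ ∑ i ∈ Finset.range (s + 1), l.choose i := by
  classical
  let W : Finset ((Fin l → ZMod 2) → ℚ) :=
    ((Finset.range (s + 1)).biUnion fun i => Finset.powersetCard i Finset.univ).image
      fun S x => ∏ i ∈ S, if x i = 0 then 0 else 1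
  have hW : squarefreeMonomialSpan l s ≤ Submodule.span ℚ (W : Set ((Fin l → ZMod 2) → ℚ)) := by
    refine Submodule.span_mono ?_
    rintro f ⟨S, hS, rfl⟩
    refine Finset.mem_coe.2 (Finset.mem_image.2 ⟨S, ?_, rfl⟩)
    simp only [Finset.mem_biUnion, Finset.mem_range, Finset.mem_powersetCard]
    exact ⟨S.card, by lia, Finset.subset_univ _, rfl⟩
  have hcard := linearIndependent_le_span' v hv (W : Set ((Fin l → ZMod 2) → ℚ))
    (Set.range_subset_iff.2 fun j => hW (hmem j))
  rw [Cardinal.mk_fintype, Nat.cast_le] at hcard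
  calc Fintype.card ι ≤ W.card := by simpa using hcard
    _ ≤ _ := Finset.card_image_le
    _ ≤ _ := Finset.card_biUnion_le
    _ = _ := by simp

/-- **Delsarte's bound for few-distance codes: `|C| ≤ ∑_{i=0}^{s} binom(l,i)`.**
Let `C ⊆ 𝔽₂^l` be a binary code of length `l` such that the set of Hamming distances
`{d_H(x,y) : x, y ∈ C, x ≠ y}` between distinct codewords has at most `s` elements.
Then `|C| ≤ ∑_{i=0}^{s} binom(l,i)`. -/
theorem delsarte_few_distance_bound
    (l s : ℕ) (C : Finset (Fin l → ZMod 2))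
    (hdist : ({d : ℕ | ∃ x ∈ C, ∃ y ∈ C, x ≠ y ∧ hammingDist x y = d} : Set ℕ).ncard ≤ s) :
    C.card ≤ ∑ i ∈ Finset.range (s + 1), l.choose i := by
  set A : Set ℕ := {d : ℕ | ∃ x ∈ C, ∃ y ∈ C, x ≠ y ∧ hammingDist x y = d} with hA
  have hfin : A.Finite := by
    refine (Set.finite_Iic l).subset ?_
    rintro d ⟨x, -, y, -, -, rfl⟩
    simpa using hammingDist_le_card_fintype (x := x) (y := y)
  let D := hfin.toFinset
  have hD : D.card ≤ s := by rwa [← Set.ncard_eq_toFinset_card A hfin]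
  let v : C → (Fin l → ZMod 2) → ℚ := fun a x => ∏ d ∈ D, ((d : ℚ) - hammingDist a.1 x)
  have hself (a : C) : v a a ≠ 0 := by
    refine Finset.prod_ne_zero_iff.2 fun d hd => ?_
    obtain ⟨x, -, y, -, hxy, rfl⟩ := hfin.mem_toFinset.1 hd
    simpa using hxy
  have hother (a b : C) (h : a ≠ b) : v a b = 0 :=
    Finset.prod_eq_zero (i := hammingDist a.1 b.1)
      (hfin.mem_toFinset.2 ⟨a, a.2, b, b.2, Subtype.coe_injective.ne h, rfl⟩) (sub_self _)
  have hv : LinearIndependent ℚ v := by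
    refine Fintype.linearIndependent_iff.2 fun c hc b => ?_
    have hb := congrFun hc b
    rw [Finset.sum_apply, Finset.sum_eq_single b
      (fun a _ hab => by simp [hother a b hab]) (by simp)] at hb
    exact (mul_eq_zero.1 hb).resolve_right (hself b)
  simpa using card_le_of_linearIndependent_mem_squarefreeMonomialSpan hv fun a =>
    squarefreeMonomialSpan_mono l hD (prod_sub_hammingDist_mem_squarefreeMonomialSpan a.1 D)
end
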